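/- Call a subset B ⊆ K a block if B has exactly 6 elements and B = { Q ∈ K : f(v_Q) = 0 } for some nonzero linear functional f on F⁶, where v_Q denotes any representative of Q. Then every 5-element subset of K is contained in exactly one block; that is, K together with its blocks is a 5-(12,6,1) design (Witt's design W₁₂). -/

import Mathlib

/-- `F = GF(3)` realized as `ZMod 3`. -/
abbrev F3 := ZMod 3

/-- `PG(5,3)`: the projective space of `F³ ⁶` (projectivization of `Fin 6 → F`). -/
abbrev PG5 := Projectivization F3 (Fin 6 → F3)

/-- `v` is a representative vector of the projective point `Q`. -/
def IsRep6 (v : Fin 6 → F3) (Q : PG5) : Prop :=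
  ∃ hv : v ≠ 0, Projectivization.mk F3 v hv = Q

/-- The set `K ⊆ PG(5,3)`. -/
def Kset : Set PG5 :=
  {Q | ∃ x₀ x₁ x₂ : F3, (x₁, x₂) ≠ (0, 0) ∧
    IsRep6 ![x₀ ^ 2 + 1, x₀ * x₁, x₀ * x₂, x₁ ^ 2, x₁ * x₂, x₂ ^ 2] Q}


/-- `B ⊆ K` is a block if it has exactly 6 elements and is cut out of `K` by a
nonzero linear functional on `F⁶` (a hyperplane section of `K` with six points). -/
def IsBlock (B : Set PG5) : Prop :=
  B.ncard = 6 ∧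
  ∃ f : (Fin 6 → F3) →ₗ[F3] F3, f ≠ 0 ∧
    B = {Q ∈ Kset | ∀ v, IsRep6 v Q → f v = 0}

/-- The vector attached to a triple in the definition of `Kset`. -/
def conicVec (x : F3 × F3 × F3) : Fin 6 → F3 :=
  ![x.1 ^ 2 + 1, x.1 * x.2.1, x.1 * x.2.2, x.2.1 ^ 2, x.2.1 * x.2.2, x.2.2 ^ 2]

/-- Representatives, up to sign, of the triples with nonzero last two coordinates:
a point of the projective line together with an element of `F3`. -/
def signRep : Option F3 × F3 → F3 × F3 × F3
  | (none, x) => (x, 0, 1)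
  | (some t, x) => (x, 1, t)

/-- The vectors representing the twelve points of `Kset`. -/
def kVec (p : Option F3 × F3) : Fin 6 → F3 := conicVec (signRep p)

theorem kVec_ne_zero : ∀ p, kVec p ≠ 0 := by decide +kernel

theorem eq_of_smul_kVec_eq :
    ∀ (p q : Option F3 × F3) (c : F3), c • kVec q = kVec p → p = q := by decide +kernel

theorem exists_conicVec_eq_kVec :
    ∀ x₀ x₁ x₂ : F3, (x₁, x₂) ≠ (0, 0) → ∃ p, conicVec (x₀, x₁, x₂) = kVec p := by
  decide +kernel

theorem signRep_snd_ne_zero : ∀ p, (signRep p).2 ≠ (0, 0) := by decide +kernel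

theorem card_dotProduct_kVec_eq_zero :
    ∀ a b c d e g : F3, ![a, b, c, d, e, g] ≠ 0 →
      (Finset.univ.filter fun p => kVec p ⬝ᵥ ![a, b, c, d, e, g] = 0).card < 5 ∨
      (Finset.univ.filter fun p => kVec p ⬝ᵥ ![a, b, c, d, e, g] = 0).card = 6 := by
  decide +kernel

/-- The points of `Kset`, indexed by `Option F3 × F3`. -/
def kPoint (p : Option F3 × F3) : PG5 := Projectivization.mk F3 (kVec p) (kVec_ne_zero p)

theorem kPoint_injective : Function.Injective kPoint := by
  intro p q h
  obtain ⟨c, hc⟩ := (Projectivization.mk_eq_mk_iff' _ _ _ _ _).1 h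
  exact eq_of_smul_kVec_eq p q c hc

theorem Kset_eq_range_kPoint : Kset = Set.range kPoint := by
  ext Q
  constructor
  · rintro ⟨x₀, x₁, x₂, hx, hv, rfl⟩
    obtain ⟨p, hp⟩ := exists_conicVec_eq_kVec x₀ x₁ x₂ hx
    refine ⟨p, ?_⟩
    simp only [kPoint, ← hp]
    rfl
  · rintro ⟨p, rfl⟩
    exact ⟨_, _, _, signRep_snd_ne_zero p, kVec_ne_zero p, rfl⟩

/-- The indices of the points of `Kset` on the hyperplane `f = 0`. -/
def zeroIndices (f : (Fin 6 → F3) →ₗ[F3] F3) : Finset (Option F3 × F3) :=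
  Finset.univ.filter fun p => f (kVec p) = 0

theorem mem_zeroIndices {f : (Fin 6 → F3) →ₗ[F3] F3} {p : Option F3 × F3} :
    p ∈ zeroIndices f ↔ f (kVec p) = 0 := by
  simp [zeroIndices]

theorem hyperplane_section_eq_image (f : (Fin 6 → F3) →ₗ[F3] F3) :
    {Q ∈ Kset | ∀ v, IsRep6 v Q → f v = 0} = kPoint '' zeroIndices f := by
  ext Q
  rw [Kset_eq_range_kPoint]
  constructor
  · rintro ⟨⟨p, rfl⟩, h⟩
    exact ⟨p, mem_zeroIndices.2 (h _ ⟨kVec_ne_zero p, rfl⟩), rfl⟩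
  · rintro ⟨p, hp, rfl⟩
    refine ⟨⟨p, rfl⟩, ?_⟩
    rintro v ⟨hv, h⟩
    obtain ⟨c, rfl⟩ := (Projectivization.mk_eq_mk_iff' _ _ _ _ _).1 h
    rw [map_smul, mem_zeroIndices.1 hp, smul_zero]

theorem card_zeroIndices {f : (Fin 6 → F3) →ₗ[F3] F3} (hf : f ≠ 0) :
    (zeroIndices f).card < 5 ∨ (zeroIndices f).card = 6 := by
  obtain ⟨a, rfl⟩ := (dotProductEquiv F3 (Fin 6)).surjective f
  have ha : a = ![a 0, a 1, a 2, a 3, a 4, a 5] := by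
    ext i; fin_cases i <;> rfl
  have h := card_dotProduct_kVec_eq_zero (a 0) (a 1) (a 2) (a 3) (a 4) (a 5)
  rw [← ha] at h
  simpa [zeroIndices, dotProduct_comm] using h (by rintro rfl; simp at hf)

theorem card_zeroIndices_eq_six {f : (Fin 6 → F3) →ₗ[F3] F3} (hf : f ≠ 0)
    {T : Finset (Option F3 × F3)} (hT : T.card = 5) (h : T ⊆ zeroIndices f) :
    (zeroIndices f).card = 6 := by
  have := Finset.card_le_card h
  rcases card_zeroIndices hf with h | h <;> omega

theorem exists_ne_zero_subset_zeroIndices {T : Finset (Option F3 × F3)} (hT : T.card = 5) :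
    ∃ f : (Fin 6 → F3) →ₗ[F3] F3, f ≠ 0 ∧ T ⊆ zeroIndices f := by
  let ev : ((Fin 6 → F3) →ₗ[F3] F3) →ₗ[F3] (T → F3) :=
    LinearMap.pi fun p => LinearMap.applyₗ (kVec p)
  have hev : LinearMap.ker ev ≠ ⊥ := by
    apply LinearMap.ker_ne_bot_of_finrank_lt
    have : Module.finrank F3 ((Fin 6 → F3) →ₗ[F3] F3) = 6 := by
      simp
    simp [this, hT]
  obtain ⟨f, hf, hf0⟩ := (Submodule.ne_bot_iff _).1 hev
  exact ⟨f, hf0, fun p hp => mem_zeroIndices.2 (congrFun (LinearMap.mem_ker.1 hf) ⟨p, hp⟩)⟩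

/-- Any pair of scalars is killed by one of the four members of the pencil they span. -/
theorem pencil_covers : ∀ x y : F3, x = 0 ∨ y = 0 ∨ x + y = 0 ∨ x - y = 0 := by decide

theorem zeroIndices_eq {f g : (Fin 6 → F3) →ₗ[F3] F3} (hf : f ≠ 0) (hg : g ≠ 0)
    {T : Finset (Option F3 × F3)} (hT : T.card = 5)
    (hTf : T ⊆ zeroIndices f) (hTg : T ⊆ zeroIndices g) :
    zeroIndices f = zeroIndices g := by
  by_cases hadd : f + g = 0
  · ext p
    simp [mem_zeroIndices, eq_neg_of_add_eq_zero_left hadd]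
  by_cases hsub : f - g = 0
  · rw [sub_eq_zero.1 hsub]
  exfalso
  have hTa : T ⊆ zeroIndices (f + g) := fun p hp => by
    simp [mem_zeroIndices, mem_zeroIndices.1 (hTf hp), mem_zeroIndices.1 (hTg hp)]
  have hTs : T ⊆ zeroIndices (f - g) := fun p hp => by
    simp [mem_zeroIndices, mem_zeroIndices.1 (hTf hp), mem_zeroIndices.1 (hTg hp)]
  have hone : ∀ k : (Fin 6 → F3) →ₗ[F3] F3, k ≠ 0 → T ⊆ zeroIndices k →
      (zeroIndices k \ T).card = 1 := fun k hk hTk => by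
    rw [Finset.card_sdiff_of_subset hTk, card_zeroIndices_eq_six hk hT hTk, hT]
  have hcover : Finset.univ \ T ⊆ (zeroIndices f \ T ∪ zeroIndices g \ T) ∪
      (zeroIndices (f + g) \ T ∪ zeroIndices (f - g) \ T) := by
    intro p hp
    have := pencil_covers (f (kVec p)) (g (kVec p))
    simp only [Finset.mem_union, Finset.mem_sdiff, mem_zeroIndices, LinearMap.add_apply,
      LinearMap.sub_apply, Finset.mem_univ, true_and] at hp ⊢
    tauto
  have hle := Finset.card_le_card hcover
  have hcard : (Finset.univ \ T).card = 7 := by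
    rw [Finset.card_sdiff_of_subset (Finset.subset_univ T), hT]
    simp
  have h₁ := Finset.card_union_le (zeroIndices f \ T ∪ zeroIndices g \ T)
    (zeroIndices (f + g) \ T ∪ zeroIndices (f - g) \ T)
  have h₂ := Finset.card_union_le (zeroIndices f \ T) (zeroIndices g \ T)
  have h₃ := Finset.card_union_le (zeroIndices (f + g) \ T) (zeroIndices (f - g) \ T)
  rw [hone f hf hTf, hone g hg hTg] at h₂
  rw [hone _ hadd hTa, hone _ hsub hTs] at h₃
  omega

/-- Every 5-element subset of `K` is contained in exactly one block;
that is, `K` together with its blocks is a 5-(12,6,1) design (Witt's design `W₁₂`). -/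
theorem Kset_blocks_form_Witt_design :
    ∀ S : Set PG5, S ⊆ Kset → S.ncard = 5 →
      ∃! B : Set PG5, IsBlock B ∧ S ⊆ B := by
  intro S hS hcard
  rw [Kset_eq_range_kPoint] at hS
  obtain ⟨T', rfl⟩ := Set.subset_range_iff_exists_image_eq.1 hS
  lift T' to Finset (Option F3 × F3) using T'.toFinite with T
  rw [Set.ncard_image_of_injective _ kPoint_injective, Set.ncard_coe_finset] at hcard
  obtain ⟨f, hf, hTf⟩ := exists_ne_zero_subset_zeroIndices hcard
  refine ⟨kPoint '' zeroIndices f, ⟨⟨?_, f, hf, (hyperplane_section_eq_image f).symm⟩,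
    Set.image_mono (Finset.coe_subset.2 hTf)⟩, ?_⟩
  · rw [Set.ncard_image_of_injective _ kPoint_injective, Set.ncard_coe_finset]
    exact card_zeroIndices_eq_six hf hcard hTf
  · rintro B ⟨⟨-, g, hg, rfl⟩, hB⟩
    rw [hyperplane_section_eq_image, Set.image_subset_image_iff kPoint_injective,
      Finset.coe_subset] at hB
    rw [hyperplane_section_eq_image, zeroIndices_eq hg hf hcard hB hTf]
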